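/- arXiv:2306.03613 — 2 statements merged into one kernel-verified Lean document; each statement's English description precedes it below -/
import Mathlib

section
/- Let G be a connected graph containing no K_4/e as a graph minor, where K_4/e is the graph obtained from K_4 by contracting one edge (two vertices joined by two pairs of parallel edges plus an edge between two further vertices; concretely, 3 vertices with a triangle where two of the edges are doubled). Then every block of G is a bridge, a cycle, or a subdivision of A_t for some t >= 3, where A_t is two vertices joined by t parallel edges. -/
open scoped Classical
noncomputable section

/-- A multigraph on vertex type `V` with edge type `E`: each edge has an unordered pair
of endpoints. -/
structure MGraph (V E : Type*) where
  ends : E → Sym2 V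

namespace MGraph

variable {V E : Type*}

/-- Adjacency: some edge joins `u` and `v`. -/
def adj (G : MGraph V E) (u v : V) : Prop := ∃ e : E, G.ends e = s(u, v)

/-- `G` is connected. -/
def Connected (G : MGraph V E) : Prop :=
  Nonempty V ∧ ∀ u v : V, Relation.ReflTransGen G.adj u v

/-- The edge set `F` forms a path from `u` to `v` (with distinct vertices). -/
def IsPathSet (G : MGraph V E) (F : Set E) (u v : V) : Prop :=
  ∃ (m : ℕ) (w : Fin (m + 1) → V) (g : Fin m → E),
    Function.Injective w ∧ Function.Injective g ∧ Set.range g = F ∧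
    w 0 = u ∧ w (Fin.last m) = v ∧
    ∀ i : Fin m, G.ends (g i) = s(w i.castSucc, w i.succ)

/-- The edge set `F` forms a cycle (closed walk with distinct vertices and edges). -/
def IsCycleSet (G : MGraph V E) (F : Set E) : Prop :=
  ∃ (m : ℕ) (w : Fin (m + 1) → V) (g : Fin (m + 1) → E),
    Function.Injective w ∧ Function.Injective g ∧ Set.range g = F ∧
    ∀ i : Fin (m + 1), G.ends (g i) = s(w i, w (i + 1))

/-- A bridge: an edge lying on no cycle. -/
def IsBridge (G : MGraph V E) (e : E) : Prop := ∀ F : Set E, G.IsCycleSet F → e ∉ F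

/-- Two edges lie on a common cycle (or are equal). -/
def cycRel (G : MGraph V E) (e f : E) : Prop :=
  e = f ∨ ∃ F : Set E, G.IsCycleSet F ∧ e ∈ F ∧ f ∈ F

/-- A block of `G`, viewed through its edge set: an equivalence class of the
"common cycle" relation on the edges. -/
def IsBlock (G : MGraph V E) (B : Set E) : Prop :=
  ∃ e : E, B = {f | Relation.EqvGen G.cycRel e f}

/-- The vertices incident to an edge set. -/
def vtxOf (G : MGraph V E) (F : Set E) : Set V := {x | ∃ e ∈ F, x ∈ G.ends e}

/-- The edge set `B` forms a subdivision of `A_t` for some `t ≥ 3`: a union of `t`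
pairwise internally vertex-disjoint paths between two fixed distinct vertices. -/
def IsSubdivA (G : MGraph V E) (B : Set E) : Prop :=
  ∃ t : ℕ, 3 ≤ t ∧ ∃ u v : V, u ≠ v ∧ ∃ P : Fin t → Set E,
    (∀ a, G.IsPathSet (P a) u v) ∧
    (∀ a b, a ≠ b → P a ∩ P b = ∅ ∧ G.vtxOf (P a) ∩ G.vtxOf (P b) ⊆ {u, v}) ∧
    (⋃ a, P a) = B

/-- A nonempty vertex set that is connected inside itself. -/
def SubConnected (G : MGraph V E) (S : Set V) : Prop :=
  S.Nonempty ∧ ∀ x ∈ S, ∀ y ∈ S,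
    Relation.ReflTransGen (fun a b => a ∈ S ∧ b ∈ S ∧ G.adj a b) x y

/-- Edge `e` joins the vertex sets `A` and `B`. -/
def linksSets (G : MGraph V E) (e : E) (A B : Set V) : Prop :=
  ∃ a ∈ A, ∃ b ∈ B, G.ends e = s(a, b)

/-- `G` has `K₄/e` as a graph minor: `K₄/e` has vertices `u, v, w` with two parallel
`u–w` edges, two parallel `v–w` edges and a `u–v` edge; a minor model consists of three
disjoint connected branch sets together with five distinct edges joining them
accordingly. -/
def HasK4eMinor (G : MGraph V E) : Prop :=
  ∃ Bu Bv Bw : Set V,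
    G.SubConnected Bu ∧ G.SubConnected Bv ∧ G.SubConnected Bw ∧
    Bu ∩ Bv = ∅ ∧ Bu ∩ Bw = ∅ ∧ Bv ∩ Bw = ∅ ∧
    ∃ f₁ f₂ f₃ f₄ f₅ : E, [f₁, f₂, f₃, f₄, f₅].Nodup ∧
      G.linksSets f₁ Bu Bw ∧ G.linksSets f₂ Bu Bw ∧
      G.linksSets f₃ Bv Bw ∧ G.linksSets f₄ Bv Bw ∧
      G.linksSets f₅ Bu Bv

/-- A path of length `m`, with vertices and edges enumerated by natural numbers. -/
structure IsNatPath (G : MGraph V E) (m : ℕ) (w : ℕ → V) (g : ℕ → E) : Prop where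
  inj : ∀ i ≤ m, ∀ j ≤ m, w i = w j → i = j
  ends : ∀ i < m, G.ends (g i) = s(w i, w (i + 1))

theorem IsNatPath.edge_inj {G : MGraph V E} {m : ℕ} {w : ℕ → V} {g : ℕ → E}
    (h : G.IsNatPath m w g) {i j : ℕ} (hi : i < m) (hj : j < m) (he : g i = g j) : i = j := by
  have h1 := h.ends i hi
  rw [he, h.ends j hj, Sym2.eq_iff] at h1
  rcases h1 with ⟨h1, -⟩ | ⟨h1, h2⟩
  · exact (h.inj _ (by omega) _ (by omega) h1).symm
  · have := h.inj _ (by omega) _ (by omega) h1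
    have := h.inj _ (by omega) _ (by omega) h2
    omega

theorem IsNatPath.reverse {G : MGraph V E} {m : ℕ} {w : ℕ → V} {g : ℕ → E}
    (h : G.IsNatPath m w g) :
    G.IsNatPath m (fun i => w (m - i)) (fun i => g (m - 1 - i)) := by
  refine ⟨fun i hi j hj hw => ?_, fun i hi => ?_⟩
  · have := h.inj _ (by omega) _ (by omega) hw
    omega
  · have h1 := h.ends (m - 1 - i) (by omega)
    rw [show m - 1 - i + 1 = m - i by omega, Sym2.eq_swap] at h1
    simpa [show m - (i + 1) = m - 1 - i by omega] using h1

theorem image_Iio_reverse (g : ℕ → E) (m : ℕ) :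
    (fun i => g (m - 1 - i)) '' Set.Iio m = g '' Set.Iio m := by
  ext e
  simp only [Set.mem_image, Set.mem_Iio]
  constructor
  · rintro ⟨i, hi, rfl⟩
    exact ⟨m - 1 - i, by omega, rfl⟩
  · rintro ⟨i, hi, rfl⟩
    exact ⟨m - 1 - i, by omega, by congr 1; omega⟩

theorem IsNatPath.isPathSet {G : MGraph V E} {m : ℕ} {w : ℕ → V} {g : ℕ → E}
    (h : G.IsNatPath m w g) : G.IsPathSet (g '' Set.Iio m) (w 0) (w m) := by
  refine ⟨m, fun i => w i, fun i => g i, fun i j hij => ?_, fun i j hij => ?_, ?_, rfl, rfl,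
    fun i => ?_⟩
  · exact Fin.ext (h.inj _ (by omega) _ (by omega) hij)
  · exact Fin.ext (h.edge_inj i.2 j.2 hij)
  · ext e
    simp only [Set.mem_range, Set.mem_image, Set.mem_Iio]
    exact ⟨fun ⟨i, hi⟩ => ⟨i, i.2, hi⟩, fun ⟨i, hi, he⟩ => ⟨⟨i, hi⟩, he⟩⟩
  · simpa using h.ends i i.2

theorem IsPathSet.exists_isNatPath {G : MGraph V E} {F : Set E} {u v : V}
    (h : G.IsPathSet F u v) (huv : u ≠ v) :
    ∃ m w g, 0 < m ∧ G.IsNatPath m w g ∧ g '' Set.Iio m = F ∧ w 0 = u ∧ w m = v := by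
  obtain ⟨m, w, g, hw, hg, hF, h0, hm, he⟩ := h
  have hpos : 0 < m := by
    rcases Nat.eq_zero_or_pos m with rfl | h
    · exact absurd (h0.symm.trans hm) huv
    · exact h
  refine ⟨m, fun i => if hi : i < m + 1 then w ⟨i, hi⟩ else u,
    fun i => if hi : i < m then g ⟨i, hi⟩ else g ⟨0, hpos⟩, hpos, ⟨?_, ?_⟩, ?_, ?_, ?_⟩
  · intro i hi j hj hij
    simp only [show i < m + 1 by omega, show j < m + 1 by omega, dif_pos] at hij
    simpa using hw hij
  · intro i hi
    simp only [hi, show i < m + 1 by omega, show i + 1 < m + 1 by omega, dif_pos]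
    exact he ⟨i, hi⟩
  · rw [← hF]
    ext e
    simp only [Set.mem_range, Set.mem_image, Set.mem_Iio]
    constructor
    · rintro ⟨i, hi, rfl⟩
      exact ⟨⟨i, hi⟩, by simp [hi]⟩
    · rintro ⟨i, rfl⟩
      exact ⟨i, i.2, by simp⟩
  · simpa using h0
  · simpa [Fin.last] using hm

theorem IsPathSet.symm {G : MGraph V E} {F : Set E} {u v : V}
    (h : G.IsPathSet F u v) (huv : u ≠ v) : G.IsPathSet F v u := by
  obtain ⟨m, w, g, -, hp, rfl, rfl, rfl⟩ := h.exists_isNatPath huv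
  simpa [image_Iio_reverse] using hp.reverse.isPathSet

theorem IsNatPath.vtxOf_eq {G : MGraph V E} {m : ℕ} {w : ℕ → V} {g : ℕ → E}
    (h : G.IsNatPath m w g) (hm : 0 < m) : G.vtxOf (g '' Set.Iio m) = w '' Set.Iic m := by
  ext x
  simp only [vtxOf, Set.mem_ofPred_eq, Set.mem_image, Set.mem_Iio, Set.mem_Iic]
  constructor
  · rintro ⟨_, ⟨i, hi, rfl⟩, hx⟩
    rw [h.ends i hi, Sym2.mem_iff] at hx
    rcases hx with rfl | rfl
    · exact ⟨i, by omega, rfl⟩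
    · exact ⟨i + 1, by omega, rfl⟩
  · rintro ⟨i, hi, rfl⟩
    rcases Nat.lt_or_ge i m with h1 | h1
    · exact ⟨_, ⟨i, h1, rfl⟩, by simp [h.ends i h1]⟩
    · refine ⟨_, ⟨m - 1, by omega, rfl⟩, ?_⟩
      rw [h.ends (m - 1) (by omega), show m - 1 + 1 = i by omega]
      simp

theorem IsPathSet.left_mem {G : MGraph V E} {F : Set E} {u v : V}
    (h : G.IsPathSet F u v) (huv : u ≠ v) : u ∈ G.vtxOf F := by
  obtain ⟨m, w, g, hm, hp, rfl, rfl, rfl⟩ := h.exists_isNatPath huv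
  rw [hp.vtxOf_eq hm]
  exact ⟨0, by simp, rfl⟩

theorem IsPathSet.right_mem {G : MGraph V E} {F : Set E} {u v : V}
    (h : G.IsPathSet F u v) (huv : u ≠ v) : v ∈ G.vtxOf F :=
  (h.symm huv).left_mem huv.symm

theorem IsPathSet.nonempty {G : MGraph V E} {F : Set E} {u v : V}
    (h : G.IsPathSet F u v) (huv : u ≠ v) : F.Nonempty := by
  obtain ⟨e, he, -⟩ := h.left_mem huv
  exact ⟨e, he⟩

theorem vtxOf_mono (G : MGraph V E) {A B : Set E} (h : A ⊆ B) : G.vtxOf A ⊆ G.vtxOf B :=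
  fun _ ⟨e, he, hx⟩ => ⟨e, h he, hx⟩

/-! ### Connected vertex sets -/

theorem adj_symm {G : MGraph V E} {u v : V} (h : G.adj u v) : G.adj v u := by
  obtain ⟨e, he⟩ := h
  exact ⟨e, by rw [he, Sym2.eq_swap]⟩

theorem subConnected_of_root {G : MGraph V E} {S : Set V} {r : V} (hr : r ∈ S)
    (h : ∀ x ∈ S, Relation.ReflTransGen (fun a b => a ∈ S ∧ b ∈ S ∧ G.adj a b) r x) :
    G.SubConnected S := by
  have : Std.Symm (fun a b => a ∈ S ∧ b ∈ S ∧ G.adj a b) :=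
    ⟨fun _ _ ⟨ha, hb, hab⟩ => ⟨hb, ha, adj_symm hab⟩⟩
  exact ⟨⟨r, hr⟩, fun x hx y hy => (Std.Symm.symm _ _ (h x hx)).trans (h y hy)⟩

theorem SubConnected.union {G : MGraph V E} {S T : Set V} (hS : G.SubConnected S)
    (hT : G.SubConnected T) {r : V} (hrS : r ∈ S) (hrT : r ∈ T) : G.SubConnected (S ∪ T) := by
  refine subConnected_of_root (r := r) (Or.inl hrS) ?_
  rintro x (hx | hx)
  · exact (hS.2 r hrS x hx).lift id fun a b ⟨ha, hb, hab⟩ => ⟨Or.inl ha, Or.inl hb, hab⟩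
  · exact (hT.2 r hrT x hx).lift id fun a b ⟨ha, hb, hab⟩ => ⟨Or.inr ha, Or.inr hb, hab⟩

theorem IsNatPath.subConnected {G : MGraph V E} {m : ℕ} {w : ℕ → V} {g : ℕ → E}
    (h : G.IsNatPath m w g) {a b : ℕ} (hab : a ≤ b) (hb : b ≤ m) :
    G.SubConnected (w '' Set.Icc a b) := by
  refine subConnected_of_root (r := w a) ⟨a, by simpa using hab, rfl⟩ ?_
  rintro _ ⟨i, ⟨hai, hib⟩, rfl⟩
  induction i, hai using Nat.le_induction with
  | base => exact .refl
  | succ i hai ih =>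
    exact (ih (by omega)).tail ⟨⟨i, ⟨hai, by omega⟩, rfl⟩, ⟨i + 1, ⟨by omega, hib⟩, rfl⟩,
      g i, h.ends i (by omega)⟩

/-- A connected set can absorb all of a path starting in it, except the final vertex. -/
theorem SubConnected.absorb {G : MGraph V E} {S : Set V} (hS : G.SubConnected S) {F : Set E}
    {s t : V} (hF : G.IsPathSet F s t) (hst : s ≠ t) (hs : s ∈ S) :
    G.SubConnected (S ∪ (G.vtxOf F \ {t})) ∧
      ∃ f ∈ F, ∃ z ∈ S ∪ (G.vtxOf F \ {t}), G.ends f = s(z, t) := by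
  obtain ⟨m, w, g, hm, hp, rfl, rfl, rfl⟩ := hF.exists_isNatPath hst
  have key : G.vtxOf (g '' Set.Iio m) \ {w m} = w '' Set.Icc 0 (m - 1) := by
    rw [hp.vtxOf_eq hm]
    ext x
    simp only [Set.mem_sdiff, Set.mem_image, Set.mem_Iic, Set.mem_singleton_iff, Set.mem_Icc]
    constructor
    · rintro ⟨⟨i, hi, rfl⟩, hne⟩
      have : i ≠ m := fun h => hne (by rw [h])
      exact ⟨i, by omega, rfl⟩
    · rintro ⟨i, hi, rfl⟩
      refine ⟨⟨i, by omega, rfl⟩, fun hx => ?_⟩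
      have := hp.inj _ (by omega) _ le_rfl hx
      omega
  rw [key]
  refine ⟨hS.union (hp.subConnected (by omega) (by omega)) hs ⟨0, by simp, rfl⟩, g (m - 1),
    ⟨m - 1, by simpa using hm, rfl⟩, w (m - 1), Or.inr ⟨m - 1, by simp, rfl⟩, ?_⟩
  rw [hp.ends _ (by omega), show m - 1 + 1 = m by omega]

/-! ### Minors -/

theorem linksSets.ne {G : MGraph V E} {e f : E} {A B C D : Set V} (he : G.linksSets e A B)
    (hf : G.linksSets f C D) (hA : ∀ x ∈ A, x ∉ C ∧ x ∉ D) : e ≠ f := by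
  rintro rfl
  obtain ⟨a, ha, b, hb, hab⟩ := he
  obtain ⟨c, hc, d, hd, hcd⟩ := hf
  rw [hab, Sym2.eq_iff] at hcd
  rcases hcd with ⟨rfl, rfl⟩ | ⟨rfl, rfl⟩
  · exact (hA a ha).1 hc
  · exact (hA a ha).2 hd

theorem linksSets.symm {G : MGraph V E} {e : E} {A B : Set V} (he : G.linksSets e A B) :
    G.linksSets e B A := by
  obtain ⟨a, ha, b, hb, hab⟩ := he
  exact ⟨b, hb, a, ha, by rw [hab, Sym2.eq_swap]⟩

theorem linksSets.mono {G : MGraph V E} {e : E} {A B A' B' : Set V} (he : G.linksSets e A B)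
    (hA : A ⊆ A') (hB : B ⊆ B') : G.linksSets e A' B' := by
  obtain ⟨a, ha, b, hb, hab⟩ := he
  exact ⟨a, hA ha, b, hB hb, hab⟩

/-- A triangle of connected sets, with two of its sides doubled by internally disjoint paths. -/
theorem hasK4eMinor_of_triangle {G : MGraph V E} {U T W : Set V} {e₁ e₂ e₃ : E} {F F' : Set E}
    {s t s' t' : V} (hU : G.SubConnected U) (hT : G.SubConnected T) (hW : G.SubConnected W)
    (hUT : Disjoint U T) (hUW : Disjoint U W) (hTW : Disjoint T W)
    (h₁ : G.linksSets e₁ U W) (h₂ : G.linksSets e₂ T W) (h₃ : G.linksSets e₃ U T)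
    (hF : G.IsPathSet F s t) (hs : s ∈ U) (ht : t ∈ W)
    (hF' : G.IsPathSet F' s' t') (hs' : s' ∈ T) (ht' : t' ∈ W)
    (hFd : ∀ x ∈ G.vtxOf F, x ∈ U ∪ T ∪ W → x = s ∨ x = t)
    (hFd' : ∀ x ∈ G.vtxOf F', x ∈ U ∪ T ∪ W → x = s' ∨ x = t')
    (hFF' : ∀ x ∈ G.vtxOf F, x ∈ G.vtxOf F' → x ∈ U ∪ T ∪ W)
    (he₁ : e₁ ∉ F) (he₂ : e₂ ∉ F') : G.HasK4eMinor := by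
  rw [Set.disjoint_left] at hUT hUW hTW
  have hst : s ≠ t := fun h => hUW hs (h ▸ ht)
  have hst' : s' ≠ t' := fun h => hTW hs' (h ▸ ht')
  obtain ⟨hU', f, hf, z, hz, hfz⟩ := hU.absorb hF hst hs
  obtain ⟨hT', f', hf', z', hz', hfz'⟩ := hT.absorb hF' hst' hs'
  set U' := U ∪ (G.vtxOf F \ {t}) with hU'def
  set T' := T ∪ (G.vtxOf F' \ {t'}) with hT'def
  have dUT : ∀ x ∈ U', x ∉ T' := by
    rintro x (hx | ⟨hx, hxt⟩) (hy | ⟨hy, hyt⟩)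
    · exact hUT hx hy
    · rcases hFd' x hy (Or.inl (Or.inl hx)) with rfl | rfl
      · exact hUT hx hs'
      · exact hyt rfl
    · rcases hFd x hx (Or.inl (Or.inr hy)) with rfl | rfl
      · exact hUT hs hy
      · exact hxt rfl
    · have h := hFF' x hx hy
      rcases hFd x hx h with rfl | rfl
      · rcases hFd' x hy h with rfl | rfl
        · exact hUT hs hs'
        · exact hyt rfl
      · exact hxt rfl
  have dUW : ∀ x ∈ U', x ∉ W := by
    rintro x (hx | ⟨hx, hxt⟩) hy
    · exact hUW hx hy
    · rcases hFd x hx (Or.inr hy) with rfl | rfl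
      · exact hUW hs hy
      · exact hxt rfl
  have dTW : ∀ x ∈ T', x ∉ W := by
    rintro x (hx | ⟨hx, hxt⟩) hy
    · exact hTW hx hy
    · rcases hFd' x hx (Or.inr hy) with rfl | rfl
      · exact hTW hs' hy
      · exact hxt rfl
  have l₁ : G.linksSets e₁ U' W := h₁.mono Set.subset_union_left le_rfl
  have l₂ : G.linksSets e₂ T' W := h₂.mono Set.subset_union_left le_rfl
  have l₃ : G.linksSets e₃ U' T' := h₃.mono Set.subset_union_left Set.subset_union_left
  have l₄ : G.linksSets f U' W := ⟨z, hz, t, ht, hfz⟩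
  have l₅ : G.linksSets f' T' W := ⟨z', hz', t', ht', hfz'⟩
  have aU : ∀ x ∈ U', x ∉ T' ∧ x ∉ W := fun x hx => ⟨dUT x hx, dUW x hx⟩
  have aW : ∀ x ∈ W, x ∉ U' ∧ x ∉ T' := fun x hx => ⟨fun h => dUW x h hx, fun h => dTW x h hx⟩
  refine ⟨U', T', W, hU', hT', hW, ?_, ?_, ?_, e₁, f, e₂, f', e₃, ?_, l₁, l₄, l₂, l₅, l₃⟩
  · exact Set.disjoint_iff_inter_eq_empty.1 (Set.disjoint_left.2 dUT)
  · exact Set.disjoint_iff_inter_eq_empty.1 (Set.disjoint_left.2 dUW)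
  · exact Set.disjoint_iff_inter_eq_empty.1 (Set.disjoint_left.2 dTW)
  · have n1 : e₁ ≠ f := fun h => he₁ (h ▸ hf)
    have n2 : e₂ ≠ f' := fun h => he₂ (h ▸ hf')
    have n3 := l₁.ne l₂ aU
    have n4 := l₁.ne l₅ aU
    have n5 := l₁.symm.ne l₃ aW
    have n6 := l₄.ne l₂ aU
    have n7 := l₄.ne l₅ aU
    have n8 := l₄.symm.ne l₃ aW
    have n9 := l₂.symm.ne l₃ aW
    have n10 := l₅.symm.ne l₃ aW
    simp only [List.nodup_cons, List.mem_cons, List.not_mem_nil, or_false, not_or, not_false_eq_true,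
      List.nodup_nil, and_true]
    exact ⟨⟨n1, n3, n4, n5⟩, ⟨n6, n7, n8⟩, ⟨n2, n9⟩, n10⟩

/-- Two edge sets that share no edge and no vertex other than `u` and `v`. -/
def IntDisjoint (G : MGraph V E) (A B : Set E) (u v : V) : Prop :=
  A ∩ B = ∅ ∧ G.vtxOf A ∩ G.vtxOf B ⊆ {u, v}

theorem IntDisjoint.symm {G : MGraph V E} {A B : Set E} {u v : V}
    (h : G.IntDisjoint A B u v) : G.IntDisjoint B A u v :=
  ⟨Set.inter_comm A B ▸ h.1, Set.inter_comm (G.vtxOf A) _ ▸ h.2⟩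

theorem IntDisjoint.swap {G : MGraph V E} {A B : Set E} {u v : V}
    (h : G.IntDisjoint A B u v) : G.IntDisjoint A B v u :=
  ⟨h.1, Set.pair_comm u v ▸ h.2⟩

theorem IntDisjoint.notMem {G : MGraph V E} {A B : Set E} {u v : V}
    (h : G.IntDisjoint A B u v) {e : E} (he : e ∈ A) : e ∉ B :=
  fun hB => (Set.mem_empty_iff_false e).1 (h.1 ▸ ⟨he, hB⟩)

theorem IntDisjoint.eq_or_eq {G : MGraph V E} {A B : Set E} {u v : V}
    (h : G.IntDisjoint A B u v) {x : V} (hA : x ∈ G.vtxOf A) (hB : x ∈ G.vtxOf B) :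
    x = u ∨ x = v := by
  simpa using h.2 ⟨hA, hB⟩

/-- A theta graph with an ear attached to one of its paths, in normalised position. -/
theorem hasK4eMinor_of_ear_same_aux {G : MGraph V E} {m : ℕ} {w : ℕ → V} {g : ℕ → E}
    {B C Q : Set E} {i j : ℕ} (hA : G.IsNatPath m w g) (hi : 0 < i) (hij : i < j) (hj : j ≤ m)
    (hB : G.IsPathSet B (w 0) (w m)) (hC : G.IsPathSet C (w 0) (w m))
    (hQ : G.IsPathSet Q (w i) (w j))
    (hAB : G.IntDisjoint (g '' Set.Iio m) B (w 0) (w m))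
    (hAC : G.IntDisjoint (g '' Set.Iio m) C (w 0) (w m))
    (hBC : G.IntDisjoint B C (w 0) (w m))
    (hQA : G.IntDisjoint Q (g '' Set.Iio m) (w i) (w j))
    (hQB : G.IntDisjoint Q B (w i) (w j))
    (hQC : G.IntDisjoint Q C (w i) (w j)) : G.HasK4eMinor := by
  have hne : w 0 ≠ w m := fun h => by
    have := hA.inj _ (by omega) _ le_rfl h
    omega
  have hvA := hA.vtxOf_eq (by omega)
  have memA : ∀ k ≤ m, w k ∈ G.vtxOf (g '' Set.Iio m) := fun k hk => by
    rw [hvA]; exact ⟨k, hk, rfl⟩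
  obtain ⟨hT, f, hf, z, hz, hfz⟩ := (hA.subConnected (a := 0) (b := i - 1) (by omega)
    (by omega)).absorb hB hne ⟨0, by simp, rfl⟩
  have hU := hA.subConnected (a := i) (b := j - 1) (by omega) (by omega)
  have hW := hA.subConnected (a := j) (b := m) (by omega) le_rfl
  have hsub : ∀ x ∈ w '' Set.Icc i (j - 1) ∪
      (w '' Set.Icc 0 (i - 1) ∪ (G.vtxOf B \ {w m})) ∪ w '' Set.Icc j m,
      x ∈ G.vtxOf (g '' Set.Iio m) ∨ x ∈ G.vtxOf B := by
    rintro x ((⟨k, ⟨hk, hk'⟩, rfl⟩ | ⟨k, ⟨hk, hk'⟩, rfl⟩ | hx) | ⟨k, ⟨hk, hk'⟩, rfl⟩)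
    · exact Or.inl (memA k (by omega))
    · exact Or.inl (memA k (by omega))
    · exact Or.inr hx.1
    · exact Or.inl (memA k (by omega))
  have himg : ∀ a b c d, b < c → d ≤ m →
      ∀ x, x ∈ w '' Set.Icc a b → x ∉ w '' Set.Icc c d := by
    rintro a b c d hbc hd _ ⟨k, ⟨hk, hk'⟩, rfl⟩ ⟨l, ⟨hl, hl'⟩, hkl⟩
    have := hA.inj _ (by omega) _ (by omega) hkl
    omega
  have hBU : ∀ a b, 0 < a → b ≤ m → ∀ x, x ∈ G.vtxOf B \ {w m} → x ∉ w '' Set.Icc a b := by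
    rintro a b ha hb _ ⟨hx, hxm⟩ ⟨k, ⟨hk, hk'⟩, rfl⟩
    rcases hAB.eq_or_eq (memA k (by omega)) hx with h | h
    · have := hA.inj _ (by omega) _ (by omega) h
      omega
    · exact hxm h
  refine hasK4eMinor_of_triangle (e₁ := g (j - 1)) (e₂ := f) (e₃ := g (i - 1)) hU hT hW
    ?_ ?_ ?_ ?_ ⟨z, hz, w m, ⟨m, ⟨hj, le_rfl⟩, rfl⟩, hfz⟩ ?_
    hQ ⟨i, ⟨le_rfl, by omega⟩, rfl⟩ ⟨j, ⟨le_rfl, hj⟩, rfl⟩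
    hC (Or.inl ⟨0, by simp, rfl⟩) ⟨m, ⟨hj, le_rfl⟩, rfl⟩ ?_ ?_ ?_ ?_ ?_
  · refine Set.disjoint_left.2 fun x hx hx' => ?_
    rcases hx' with hx' | hx'
    · exact himg _ _ _ _ (by omega) (by omega) x hx' hx
    · exact hBU _ _ hi (by omega) x hx' hx
  · exact Set.disjoint_left.2 (himg _ _ _ _ (by omega) (by omega))
  · refine Set.disjoint_left.2 fun x hx hx' => ?_
    rcases hx with hx | hx
    · exact himg _ _ _ _ (by omega) (by omega) x hx hx'
    · exact hBU _ _ (by omega) (by omega) x hx hx'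
  · refine ⟨w (j - 1), ⟨j - 1, ⟨by omega, le_rfl⟩, rfl⟩, w j, ⟨j, ⟨le_rfl, hj⟩, rfl⟩, ?_⟩
    rw [hA.ends _ (by omega), show j - 1 + 1 = j by omega]
  · refine ⟨w i, ⟨i, ⟨le_rfl, by omega⟩, rfl⟩, w (i - 1),
      Or.inl ⟨i - 1, ⟨by omega, le_rfl⟩, rfl⟩, ?_⟩
    rw [hA.ends _ (by omega), show i - 1 + 1 = i by omega, Sym2.eq_swap]
  · intro x hx hx'
    rcases hsub x hx' with h | h
    · exact hQA.eq_or_eq hx h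
    · exact hQB.eq_or_eq hx h
  · intro x hx hx'
    rcases hsub x hx' with h | h
    · exact hAC.eq_or_eq h hx
    · exact hBC.eq_or_eq h hx
  · intro x hx hx'
    rcases hQC.eq_or_eq hx hx' with rfl | rfl
    · exact Or.inl (Or.inl ⟨i, ⟨le_rfl, by omega⟩, rfl⟩)
    · exact Or.inr ⟨j, ⟨le_rfl, hj⟩, rfl⟩
  · exact hQA.symm.notMem ⟨j - 1, by simp; omega, rfl⟩
  · exact hBC.notMem hf

/-- A theta graph with an ear attached to one of its paths, but not at both branch vertices. -/
theorem hasK4eMinor_of_ear_same {G : MGraph V E} {A B C Q : Set E} {u v x y : V} (huv : u ≠ v)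
    (hxy : x ≠ y) (hne : ¬ (x = u ∧ y = v)) (hne' : ¬ (x = v ∧ y = u))
    (hA : G.IsPathSet A u v) (hB : G.IsPathSet B u v) (hC : G.IsPathSet C u v)
    (hQ : G.IsPathSet Q x y) (hx : x ∈ G.vtxOf A) (hy : y ∈ G.vtxOf A)
    (hAB : G.IntDisjoint A B u v) (hAC : G.IntDisjoint A C u v) (hBC : G.IntDisjoint B C u v)
    (hQA : G.IntDisjoint Q A x y) (hQB : G.IntDisjoint Q B x y) (hQC : G.IntDisjoint Q C x y) :
    G.HasK4eMinor := by
  obtain ⟨m, w, g, hm, hp, rfl, rfl, rfl⟩ := hA.exists_isNatPath huv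
  have key : ∀ i j, i < j → j ≤ m → ¬ (i = 0 ∧ j = m) → G.IsPathSet Q (w i) (w j) →
      G.IntDisjoint Q (g '' Set.Iio m) (w i) (w j) → G.IntDisjoint Q B (w i) (w j) →
      G.IntDisjoint Q C (w i) (w j) → G.HasK4eMinor := by
    intro i j hij hj hn hQ hQA hQB hQC
    rcases Nat.eq_zero_or_pos i with h0 | h0
    · have hwij : w i ≠ w j := fun h => by
        have := hp.inj _ (by omega) _ hj h
        omega
      have e1 : m - (m - i) = i := by omega
      have e2 : m - (m - j) = j := by omega
      refine hasK4eMinor_of_ear_same_aux (i := m - j) (j := m - i) (B := B) (C := C) (Q := Q)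
        hp.reverse (by omega) (by omega) (by omega) ?_ ?_ ?_ ?_ ?_ ?_ ?_ ?_ ?_ <;>
      simp only [image_Iio_reverse, e1, e2, Nat.sub_self, Nat.sub_zero]
      exacts [hB.symm huv, hC.symm huv, hQ.symm hwij, hAB.swap, hAC.swap, hBC.swap, hQA.swap,
        hQB.swap, hQC.swap]
    · exact hasK4eMinor_of_ear_same_aux hp h0 hij hj hB hC hQ hAB hAC hBC hQA hQB hQC
  rw [hp.vtxOf_eq hm] at hx hy
  obtain ⟨i, hi, rfl⟩ := hx
  obtain ⟨j, hj, rfl⟩ := hy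
  rcases lt_trichotomy i j with h | rfl | h
  · exact key i j h hj (fun ⟨h1, h2⟩ => hne (by rw [h1, h2]; exact ⟨rfl, rfl⟩)) hQ hQA hQB hQC
  · exact absurd rfl hxy
  · exact key j i h hi (fun ⟨h1, h2⟩ => hne' (by rw [h1, h2]; exact ⟨rfl, rfl⟩)) (hQ.symm hxy)
      hQA.swap hQB.swap hQC.swap

/-- A theta graph with an ear joining the interiors of two of its paths. -/
theorem hasK4eMinor_of_ear_cross {G : MGraph V E} {A B C Q : Set E} {u v x y : V} (huv : u ≠ v)
    (hxy : x ≠ y) (hA : G.IsPathSet A u v) (hB : G.IsPathSet B u v) (hC : G.IsPathSet C u v)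
    (hQ : G.IsPathSet Q x y) (hx : x ∈ G.vtxOf A) (hy : y ∈ G.vtxOf B)
    (hxB : x ∉ G.vtxOf B) (hyA : y ∉ G.vtxOf A)
    (hAB : G.IntDisjoint A B u v) (hAC : G.IntDisjoint A C u v) (hBC : G.IntDisjoint B C u v)
    (hQA : G.IntDisjoint Q A x y) (hQB : G.IntDisjoint Q B x y) (hQC : G.IntDisjoint Q C x y) :
    G.HasK4eMinor := by
  have huB := hB.left_mem huv
  have hvB := hB.right_mem huv
  have huA := hA.left_mem huv
  have hvA := hA.right_mem huv
  obtain ⟨m, w, g, hm, hp, rfl, rfl, rfl⟩ := hA.exists_isNatPath huv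
  obtain ⟨n, w', g', hn, hp', rfl, h0, hn'⟩ := hB.exists_isNatPath huv
  have memA : ∀ k ≤ m, w k ∈ G.vtxOf (g '' Set.Iio m) := fun k hk => by
    rw [hp.vtxOf_eq hm]; exact ⟨k, hk, rfl⟩
  have memB : ∀ k ≤ n, w' k ∈ G.vtxOf (g' '' Set.Iio n) := fun k hk => by
    rw [hp'.vtxOf_eq hn]; exact ⟨k, hk, rfl⟩
  have hx2 := hx
  have hy2 := hy
  rw [hp.vtxOf_eq hm] at hx2
  rw [hp'.vtxOf_eq hn] at hy2
  obtain ⟨i, hi, rfl⟩ := hx2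
  obtain ⟨j, hj, rfl⟩ := hy2
  simp only [Set.mem_Iic] at hi hj
  have hi0 : i ≠ m := fun h => hxB (h ▸ hvB)
  have hj0 : j ≠ 0 := fun h => hyA (by rw [h, h0]; exact huA)
  have hj1 : j ≠ n := fun h => hyA (by rw [h, hn']; exact hvA)
  have hsub : ∀ x ∈ w '' Set.Icc (i + 1) m ∪ w' '' Set.Icc 1 (n - 1) ∪ w '' Set.Icc 0 i,
      x ∈ G.vtxOf (g '' Set.Iio m) ∨ x ∈ G.vtxOf (g' '' Set.Iio n) := by
    rintro x ((⟨k, ⟨hk, hk'⟩, rfl⟩ | ⟨k, ⟨hk, hk'⟩, rfl⟩) | ⟨k, ⟨hk, hk'⟩, rfl⟩)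
    · exact Or.inl (memA k (by omega))
    · exact Or.inr (memB k (by omega))
    · exact Or.inl (memA k (by omega))
  have hdis : ∀ x ∈ w' '' Set.Icc 1 (n - 1), ∀ a b, b ≤ m → x ∉ w '' Set.Icc a b := by
    rintro _ ⟨k, ⟨hk, hk'⟩, rfl⟩ a b hb ⟨l, ⟨hl, hl'⟩, hkl⟩
    have h1 := memA l (by omega)
    rw [hkl] at h1
    rcases hAB.eq_or_eq h1 (memB k (by omega)) with h | h
    · have := hp'.inj k (by omega) 0 (by omega) (h.trans h0.symm)
      omega
    · have := hp'.inj k (by omega) n (by omega) (h.trans hn'.symm)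
      omega
  refine hasK4eMinor_of_triangle (e₁ := g i) (e₂ := g' 0) (e₃ := g' (n - 1))
    (hp.subConnected (a := i + 1) (b := m) (by omega) le_rfl)
    (hp'.subConnected (a := 1) (b := n - 1) (by omega) (by omega))
    (hp.subConnected (a := 0) (b := i) (by omega) (by omega))
    ?_ ?_ ?_ ?_ ?_ ?_
    (hC.symm huv) ⟨m, ⟨by omega, le_rfl⟩, rfl⟩ ⟨0, by simp, rfl⟩
    (hQ.symm hxy) ⟨j, ⟨by omega, by omega⟩, rfl⟩ ⟨i, by simp, rfl⟩ ?_ ?_ ?_ ?_ ?_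
  · exact Set.disjoint_right.2 fun x hx => hdis x hx _ _ le_rfl
  · refine Set.disjoint_left.2 ?_
    rintro _ ⟨k, ⟨hk, hk'⟩, rfl⟩ ⟨l, ⟨hl, hl'⟩, hkl⟩
    have := hp.inj _ (by omega) _ (by omega) hkl
    omega
  · exact Set.disjoint_left.2 fun x hx => hdis x hx _ _ hi
  · exact ⟨w (i + 1), ⟨i + 1, ⟨le_rfl, by omega⟩, rfl⟩, w i, ⟨i, by simp, rfl⟩,
      by rw [hp.ends i (by omega), Sym2.eq_swap]⟩
  · exact ⟨w' 1, ⟨1, ⟨le_rfl, by omega⟩, rfl⟩, w 0, ⟨0, by simp, rfl⟩,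
      by rw [hp'.ends 0 hn, Sym2.eq_swap, h0]⟩
  · refine ⟨w m, ⟨m, ⟨by omega, le_rfl⟩, rfl⟩, w' (n - 1), ⟨n - 1, ⟨by omega, le_rfl⟩, rfl⟩, ?_⟩
    rw [hp'.ends _ (by omega), show n - 1 + 1 = n by omega, Sym2.eq_swap, hn']
  · intro x hx hx'
    rcases hsub x hx' with h | h
    · exact (hAC.eq_or_eq h hx).symm
    · exact (hBC.eq_or_eq h hx).symm
  · intro x hx hx'
    rcases hsub x hx' with h | h
    · exact (hQA.eq_or_eq hx h).symm
    · exact (hQB.eq_or_eq hx h).symm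
  · intro x hx hx'
    rcases hQC.eq_or_eq hx' hx with rfl | rfl
    · exact Or.inr ⟨i, by simp, rfl⟩
    · exact Or.inl (Or.inr ⟨j, ⟨by omega, by omega⟩, rfl⟩)
  · exact hAC.notMem ⟨i, by simp; omega, rfl⟩
  · exact hQB.symm.notMem ⟨0, hn, rfl⟩

/-! ### Cycles and ears -/

/-- A cycle of length `n`, with vertices and edges enumerated periodically. -/
structure IsNatCycle (G : MGraph V E) (n : ℕ) (w : ℕ → V) (g : ℕ → E) : Prop where
  pos : 0 < n
  vtx_iff : ∀ i j, w i = w j ↔ i ≡ j [MOD n]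
  edge_iff : ∀ i j, g i = g j ↔ i ≡ j [MOD n]
  ends : ∀ i, G.ends (g i) = s(w i, w (i + 1))

theorem IsCycleSet.exists_isNatCycle {G : MGraph V E} {F : Set E} (h : G.IsCycleSet F) :
    ∃ n w g, G.IsNatCycle n w g ∧ Set.range g = F := by
  obtain ⟨m, w, g, hw, hg, rfl, he⟩ := h
  refine ⟨m + 1, fun i => w (Fin.ofNat (m + 1) i), fun i => g (Fin.ofNat (m + 1) i),
    ⟨by omega, fun i j => ?_, fun i j => ?_, fun i => ?_⟩, ?_⟩
  · rw [hw.eq_iff, Fin.ext_iff]; rfl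
  · rw [hg.eq_iff, Fin.ext_iff]; rfl
  · rw [he]
    congr 3
    ext
    simp [Fin.val_add]
  · ext e
    simp only [Set.mem_range]
    exact ⟨fun ⟨i, hi⟩ => ⟨_, hi⟩, fun ⟨i, hi⟩ => ⟨i, by simpa using hi⟩⟩

theorem IsNatCycle.shift {G : MGraph V E} {n : ℕ} {w : ℕ → V} {g : ℕ → E}
    (h : G.IsNatCycle n w g) (k : ℕ) :
    G.IsNatCycle n (fun i => w (i + k)) (fun i => g (i + k)) := by
  refine ⟨h.pos, fun i j => ?_, fun i j => ?_, fun i => ?_⟩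
  · rw [h.vtx_iff]
    exact ⟨Nat.ModEq.add_right_cancel' k, Nat.ModEq.add_right k⟩
  · rw [h.edge_iff]
    exact ⟨Nat.ModEq.add_right_cancel' k, Nat.ModEq.add_right k⟩
  · simpa [add_right_comm] using h.ends (i + k)

theorem IsNatCycle.exists_lt_edge {G : MGraph V E} {n : ℕ} {w : ℕ → V} {g : ℕ → E}
    (h : G.IsNatCycle n w g) (i : ℕ) : ∃ j < n, g j = g i :=
  ⟨i % n, Nat.mod_lt _ h.pos, (h.edge_iff _ _).2 (Nat.mod_modEq i n)⟩

theorem IsNatCycle.exists_lt_vtx {G : MGraph V E} {n : ℕ} {w : ℕ → V} {g : ℕ → E}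
    (h : G.IsNatCycle n w g) (i : ℕ) : ∃ j < n, w j = w i :=
  ⟨i % n, Nat.mod_lt _ h.pos, (h.vtx_iff _ _).2 (Nat.mod_modEq i n)⟩

theorem IsNatCycle.range_shift {G : MGraph V E} {n : ℕ} {w : ℕ → V} {g : ℕ → E}
    (h : G.IsNatCycle n w g) (k : ℕ) : Set.range (fun i => g (i + k)) = Set.range g := by
  ext e
  simp only [Set.mem_range]
  constructor
  · rintro ⟨i, rfl⟩
    exact ⟨_, rfl⟩
  · rintro ⟨i, rfl⟩
    refine ⟨i + k * (n - 1), (h.edge_iff _ _).2 ?_⟩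
    have hn := h.pos
    have : i + k * (n - 1) + k = i + n * k := by
      obtain ⟨m, rfl⟩ : ∃ m, n = m + 1 := ⟨n - 1, by omega⟩
      simp only [Nat.add_sub_cancel]
      ring
    rw [this]
    simp [Nat.ModEq]

theorem IsNatCycle.isNatPath {G : MGraph V E} {n : ℕ} {w : ℕ → V} {g : ℕ → E}
    (h : G.IsNatCycle n w g) (a : ℕ) {m : ℕ} (hm : m < n) :
    G.IsNatPath m (fun i => w (a + i)) (fun i => g (a + i)) := by
  refine ⟨fun i hi j hj hij => ?_, fun i hi => h.ends (a + i)⟩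
  have := Nat.ModEq.add_left_cancel' a ((h.vtx_iff _ _).1 hij)
  exact Nat.ModEq.eq_of_lt_of_lt this (by omega) (by omega)

/-- A cycle that has edges inside and outside `H` contains an ear of `H`. -/
theorem exists_ear {G : MGraph V E} {F H : Set E} (hF : G.IsCycleSet F) {e f : E} (he : e ∈ F)
    (heH : e ∈ H) (hf : f ∈ F) (hfH : f ∉ H) :
    ∃ Q x y, x ≠ y ∧ G.IsPathSet Q x y ∧ x ∈ G.vtxOf H ∧ y ∈ G.vtxOf H ∧ Q ⊆ F ∧
      G.IntDisjoint Q H x y := by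
  obtain ⟨n, w₀, g₀, hc₀, rfl⟩ := hF.exists_isNatCycle
  obtain ⟨k₀, rfl⟩ := he
  have hr := hc₀.range_shift k₀
  obtain ⟨w, hw⟩ : ∃ w, w = fun i => w₀ (i + k₀) := ⟨_, rfl⟩
  obtain ⟨g, hg⟩ : ∃ g, g = fun i => g₀ (i + k₀) := ⟨_, rfl⟩
  have hc : G.IsNatCycle n w g := by rw [hw, hg]; exact hc₀.shift k₀
  rw [← hg] at hr
  have hg0 : g 0 ∈ H := by simpa [hg] using heH
  rw [← hr] at hf ⊢
  clear hr hw hg hc₀ heH hF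
  obtain ⟨k₁, rfl⟩ := hf
  obtain ⟨k, hkn, hk⟩ := hc.exists_lt_edge k₁
  rw [← hk] at hfH
  have hk0 : k ≠ 0 := by rintro rfl; exact hfH hg0
  have hw1 : w 1 ∈ G.vtxOf H := ⟨_, hg0, by simp [hc.ends 0]⟩
  have hwn : w n ∈ G.vtxOf H := by
    rw [(hc.vtx_iff n 0).2 (by simp [Nat.ModEq])]
    exact ⟨_, hg0, by simp [hc.ends 0]⟩
  obtain ⟨a, ⟨ha1, hak, haH⟩, hamax⟩ : ∃ a, (1 ≤ a ∧ a ≤ k ∧ w a ∈ G.vtxOf H) ∧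
      ∀ i, a < i → i ≤ k → w i ∉ G.vtxOf H := by
    refine ⟨Nat.findGreatest (fun i => w i ∈ G.vtxOf H) k, ⟨?_, Nat.findGreatest_le k, ?_⟩,
      fun i hi hik => Nat.findGreatest_is_greatest hi hik⟩
    · exact Nat.le_findGreatest (by omega) hw1
    · exact Nat.findGreatest_spec (P := fun i => w i ∈ G.vtxOf H) (m := 1) (by omega) hw1
  obtain ⟨b, ⟨hbk, hbn, hbH⟩, hbmin⟩ : ∃ b, (k < b ∧ b ≤ n ∧ w b ∈ G.vtxOf H) ∧
      ∀ i, k < i → i < b → w i ∉ G.vtxOf H := by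
    have hex : ∃ b, k < b ∧ w b ∈ G.vtxOf H := ⟨n, hkn, hwn⟩
    refine ⟨Nat.find hex, ⟨(Nat.find_spec hex).1, Nat.find_min' hex ⟨hkn, hwn⟩,
      (Nat.find_spec hex).2⟩, fun i hi hib hiH => Nat.find_min hex hib ⟨hi, hiH⟩⟩
  have hinner : ∀ i, a < i → i < b → w i ∉ G.vtxOf H := fun i hi hib => by
    rcases Nat.lt_or_ge k i with h | h
    · exact hbmin i h hib
    · exact hamax i hi h
  have hp := hc.isNatPath a (m := b - a) (by omega)
  have hab : a + (b - a) = b := by omega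
  refine ⟨(fun i => g (a + i)) '' Set.Iio (b - a), w a, w b, ?_, ?_, haH, hbH, ?_, ?_, ?_⟩
  rotate_left
  · have := hp.isPathSet
    simp only [Nat.add_zero, hab] at this
    exact this
  · rintro _ ⟨i, -, rfl⟩
    exact ⟨_, rfl⟩
  · refine Set.eq_empty_of_forall_notMem ?_
    rintro _ ⟨⟨i, hi, rfl⟩, hiH⟩
    simp only [Set.mem_Iio] at hi hiH
    have h1 : w (a + i) ∈ G.vtxOf H := ⟨_, hiH, by simp [hc.ends]⟩
    have h2 : w (a + i + 1) ∈ G.vtxOf H := ⟨_, hiH, by simp [hc.ends]⟩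
    have h3 : i = 0 := by
      by_contra h
      exact hinner _ (by omega) (by omega) h1
    have h4 : a + i + 1 = b := by
      by_contra h
      exact hinner _ (by omega) (by omega) h2
    rw [show a + i = k by omega] at hiH
    exact hfH hiH
  · rw [hp.vtxOf_eq (by omega)]
    rintro _ ⟨⟨i, hi, rfl⟩, hiH⟩
    simp only [Set.mem_Iic] at hi hiH
    by_contra hne
    simp only [Set.mem_insert_iff, Set.mem_singleton_iff, not_or] at hne
    have h1 : i ≠ 0 := fun h => hne.1 (by rw [h, Nat.add_zero])
    have h2 : a + i ≠ b := fun h => hne.2 (by rw [h])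
    exact hinner _ (by omega) (by omega) hiH
  · intro h
    have := hp.inj 0 (by omega) (b - a) le_rfl (by simpa [hab] using h)
    omega

/-- Two distinct vertices split a cycle into two internally disjoint paths. -/
theorem IsCycleSet.split {G : MGraph V E} {F : Set E} (hF : G.IsCycleSet F) {x y : V}
    (hxy : x ≠ y) (hx : x ∈ G.vtxOf F) (hy : y ∈ G.vtxOf F) :
    ∃ A C, G.IsPathSet A x y ∧ G.IsPathSet C x y ∧ G.IntDisjoint A C x y ∧ A ∪ C = F := by
  obtain ⟨n, w₀, g₀, hc₀, rfl⟩ := hF.exists_isNatCycle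
  have hvtx : ∀ z ∈ G.vtxOf (Set.range g₀), ∃ i, w₀ i = z := by
    rintro z ⟨_, ⟨i, rfl⟩, hz⟩
    rw [hc₀.ends, Sym2.mem_iff] at hz
    rcases hz with rfl | rfl
    exacts [⟨_, rfl⟩, ⟨_, rfl⟩]
  obtain ⟨k, rfl⟩ := hvtx x hx
  obtain ⟨l, rfl⟩ := hvtx y hy
  have hr := hc₀.range_shift k
  have hc := hc₀.shift k
  obtain ⟨l', hl'⟩ : ∃ l', w₀ (l' + k) = w₀ l := by
    refine ⟨l + k * (n - 1), (hc₀.vtx_iff _ _).2 ?_⟩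
    have hn := hc₀.pos
    have : l + k * (n - 1) + k = l + n * k := by
      obtain ⟨m, rfl⟩ : ∃ m, n = m + 1 := ⟨n - 1, by omega⟩
      simp only [Nat.add_sub_cancel]
      ring
    rw [this]
    simp [Nat.ModEq]
  obtain ⟨j, hjn, hj⟩ := hc.exists_lt_vtx l'
  obtain ⟨w, hw⟩ : ∃ w, w = fun i => w₀ (i + k) := ⟨_, rfl⟩
  obtain ⟨g, hg⟩ : ∃ g, g = fun i => g₀ (i + k) := ⟨_, rfl⟩
  have hx0 : w₀ k = w 0 := by simp [hw]
  have hyj : w₀ l = w j := by rw [← hl', hw]; exact hj.symm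
  rw [← hw, ← hg] at hc
  rw [← hr, ← hg, hx0, hyj]
  rw [hx0, hyj] at hxy
  clear hr hx hy hF hvtx
  have hj0 : 0 < j := Nat.pos_of_ne_zero fun h => hxy (by rw [h])
  have hwn : w n = w 0 := (hc.vtx_iff n 0).2 (by simp [Nat.ModEq])
  have hA := hc.isNatPath 0 (m := j) hjn
  have hC := hc.isNatPath j (m := n - j) (by omega)
  have hjn' : j + (n - j) = n := by omega
  refine ⟨g '' Set.Iio j, (fun i => g (j + i)) '' Set.Iio (n - j), by simpa using hA.isPathSet,
    ?_, ⟨?_, ?_⟩, ?_⟩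
  · have := hC.isPathSet.symm (by simpa [hjn', hwn] using hxy.symm)
    simp only [Nat.add_zero, hjn', hwn] at this
    exact this
  · refine Set.eq_empty_of_forall_notMem ?_
    rintro _ ⟨⟨i, hi, rfl⟩, ⟨i', hi', hii⟩⟩
    simp only [Set.mem_Iio] at hi hi'
    have := Nat.ModEq.eq_of_lt_of_lt ((hc.edge_iff _ _).1 hii) (by omega) (by omega)
    omega
  · have e1 := hA.vtxOf_eq hj0
    simp only [Nat.zero_add] at e1
    rw [e1, hC.vtxOf_eq (by omega)]
    rintro _ ⟨⟨i, hi, rfl⟩, ⟨i', hi', hii⟩⟩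
    simp only [Set.mem_Iic] at hi hi' hii
    by_cases h : i' = n - j
    · left
      exact hii.symm.trans (by rw [h, hjn', hwn])
    · right
      have := Nat.ModEq.eq_of_lt_of_lt ((hc.vtx_iff _ _).1 hii) (by omega) (by omega)
      simp only [Set.mem_singleton_iff]
      congr 1
      omega
  · ext e
    simp only [Set.mem_union, Set.mem_image, Set.mem_Iio, Set.mem_range]
    constructor
    · rintro (⟨i, -, rfl⟩ | ⟨i, -, rfl⟩)
      exacts [⟨_, rfl⟩, ⟨_, rfl⟩]
    · rintro ⟨i, rfl⟩
      obtain ⟨i', hi', h⟩ := hc.exists_lt_edge i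
      rw [← h]
      rcases Nat.lt_or_ge i' j with h1 | h1
      · exact Or.inl ⟨i', h1, rfl⟩
      · exact Or.inr ⟨i' - j, by omega, by congr 1; omega⟩

/-! ### Families of internally disjoint paths -/

/-- A family of `t` pairwise internally disjoint `u`–`v` paths. -/
def IsPathFamily (G : MGraph V E) {t : ℕ} (u v : V) (P : Fin t → Set E) : Prop :=
  (∀ a, G.IsPathSet (P a) u v) ∧ ∀ a b, a ≠ b → G.IntDisjoint (P a) (P b) u v

theorem IsPathFamily.cons {G : MGraph V E} {t : ℕ} {u v : V} {P : Fin t → Set E}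
    (h : G.IsPathFamily u v P) {Q : Set E} (hQ : G.IsPathSet Q u v)
    (hd : ∀ a, G.IntDisjoint Q (P a) u v) :
    G.IsPathFamily u v (Fin.cons Q P : Fin (t + 1) → Set E) := by
  refine ⟨Fin.cases hQ h.1, fun a b => ?_⟩
  cases a using Fin.cases with
  | zero =>
    cases b using Fin.cases with
    | zero => exact fun h => absurd rfl h
    | succ b => exact fun _ => hd b
  | succ a =>
    cases b using Fin.cases with
    | zero => exact fun _ => (hd a).symm
    | succ b => exact fun hab => h.2 a b (fun h => hab (by rw [h]))

theorem IntDisjoint.mono_right {G : MGraph V E} {A B B' : Set E} {u v : V}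
    (h : G.IntDisjoint A B u v) (hB : B' ⊆ B) : G.IntDisjoint A B' u v :=
  ⟨Set.subset_empty_iff.1 (h.1 ▸ Set.inter_subset_inter_right A hB),
    (Set.inter_subset_inter_right _ (G.vtxOf_mono hB)).trans h.2⟩

theorem iUnion_fin_cons {t : ℕ} (P : Fin t → Set E) (Q : Set E) :
    ⋃ a, (Fin.cons Q P : Fin (t + 1) → Set E) a = Q ∪ ⋃ a, P a := by
  ext e
  simp

/-- An ear of a cycle yields a subdivision of `A₃`. -/
theorem IsCycleSet.isSubdivA_union_ear {G : MGraph V E} {F Q : Set E} {x y : V}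
    (hF : G.IsCycleSet F) (hxy : x ≠ y) (hQ : G.IsPathSet Q x y) (hx : x ∈ G.vtxOf F)
    (hy : y ∈ G.vtxOf F) (hd : G.IntDisjoint Q F x y) : G.IsSubdivA (Q ∪ F) := by
  obtain ⟨A, C, hA, hC, hAC, rfl⟩ := hF.split hxy hx hy
  have h0 : G.IsPathFamily x y (Fin.elim0 : Fin 0 → Set E) := ⟨fun a => a.elim0, fun a => a.elim0⟩
  have h1 := h0.cons hC (fun a => a.elim0)
  have h2 := h1.cons hA (fun a => by
    cases a using Fin.cases with
    | zero => exact hAC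
    | succ a => exact a.elim0)
  have hu : ⋃ a, (Fin.cons A (Fin.cons C Fin.elim0 : Fin 1 → Set E) : Fin 2 → Set E) a = A ∪ C := by
    simp
  have h3 := h2.cons hQ (fun a => hd.mono_right (by rw [← hu]; exact Set.subset_iUnion _ a))
  exact ⟨3, le_rfl, x, y, hxy, _, h3.1, h3.2, by rw [iUnion_fin_cons, hu]⟩

/-- Without a `K₄/e` minor, every ear of a subdivision of `A_t`, `t ≥ 3`, extends it to a
subdivision of `A_{t+1}`. -/
theorem IsSubdivA.union_ear {G : MGraph V E} (hminor : ¬ G.HasK4eMinor) {H Q : Set E} {x y : V}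
    (hH : G.IsSubdivA H) (hxy : x ≠ y) (hQ : G.IsPathSet Q x y) (hx : x ∈ G.vtxOf H)
    (hy : y ∈ G.vtxOf H) (hd : G.IntDisjoint Q H x y) : G.IsSubdivA (Q ∪ H) := by
  obtain ⟨t, ht, u, v, huv, P, hP, hPd, rfl⟩ := hH
  have hdP : ∀ a, G.IntDisjoint Q (P a) x y := fun a => hd.mono_right (Set.subset_iUnion _ a)
  have hfam : G.IsPathFamily u v P := ⟨hP, hPd⟩
  by_cases h1 : x = u ∧ y = v
  · obtain ⟨rfl, rfl⟩ := h1
    have := hfam.cons hQ hdP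
    exact ⟨t + 1, by omega, x, y, huv, _, this.1, this.2, iUnion_fin_cons P Q⟩
  by_cases h2 : x = v ∧ y = u
  · obtain ⟨rfl, rfl⟩ := h2
    have := hfam.cons (hQ.symm hxy) (fun a => (hdP a).swap)
    exact ⟨t + 1, by omega, y, x, huv, _, this.1, this.2, iUnion_fin_cons P Q⟩
  refine absurd ?_ hminor
  have hthird : ∀ a b : Fin t, ∃ c, c ≠ a ∧ c ≠ b := fun a b => by
    obtain ⟨c, hc⟩ := Finset.exists_mem_notMem_of_card_lt_card (s := ({a, b} : Finset (Fin t)))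
      (t := Finset.univ) (Finset.card_le_two.trans_lt (by simpa using Nat.lt_of_succ_le ht))
    exact ⟨c, by simpa using hc⟩
  have hsame : ∀ a, x ∈ G.vtxOf (P a) → y ∈ G.vtxOf (P a) → G.HasK4eMinor := fun a hxa hya => by
    obtain ⟨b, hb, -⟩ := hthird a a
    obtain ⟨c, hca, hcb⟩ := hthird a b
    exact hasK4eMinor_of_ear_same huv hxy h1 h2 (hP a) (hP b) (hP c) hQ hxa hya (hPd a b hb.symm)
      (hPd a c hca.symm) (hPd b c hcb.symm) (hdP a) (hdP b) (hdP c)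
  obtain ⟨e, he, hxe⟩ := hx
  obtain ⟨f, hf, hyf⟩ := hy
  obtain ⟨a, ha⟩ := Set.mem_iUnion.1 he
  obtain ⟨b, hb⟩ := Set.mem_iUnion.1 hf
  have hxa : x ∈ G.vtxOf (P a) := ⟨e, ha, hxe⟩
  have hyb : y ∈ G.vtxOf (P b) := ⟨f, hb, hyf⟩
  by_cases hya : y ∈ G.vtxOf (P a)
  · exact hsame a hxa hya
  by_cases hxb : x ∈ G.vtxOf (P b)
  · exact hsame b hxb hyb
  have hab : a ≠ b := by rintro rfl; exact hya hyb
  obtain ⟨c, hca, hcb⟩ := hthird a b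
  exact hasK4eMinor_of_ear_cross huv hxy (hP a) (hP b) (hP c) hQ hxa hyb hxb hya (hPd a b hab)
    (hPd a c hca.symm) (hPd b c hcb.symm) (hdP a) (hdP b) (hdP c)

/-! ### Blocks -/

theorem eqvGen_cycRel_mem_iff {G : MGraph V E} {H : Set E}
    (h : ∀ F, G.IsCycleSet F → ∀ e ∈ F, e ∈ H → F ⊆ H) {e f : E}
    (hef : Relation.EqvGen G.cycRel e f) : e ∈ H ↔ f ∈ H := by
  induction hef with
  | rel e f hef =>
    rcases hef with rfl | ⟨F, hF, he, hf⟩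
    · rfl
    · exact ⟨fun heH => h F hF e he heH hf, fun hfH => h F hF f hf hfH he⟩
  | refl => rfl
  | symm _ _ _ ih => exact ih.symm
  | trans _ _ _ _ _ ih₁ ih₂ => exact ih₁.trans ih₂

theorem IsBlock.cycle_subset {G : MGraph V E} {B F : Set E} (hB : G.IsBlock B)
    (hF : G.IsCycleSet F) {e : E} (he : e ∈ F) (heB : e ∈ B) : F ⊆ B := by
  obtain ⟨e₀, rfl⟩ := hB
  exact fun f hf => .trans _ _ _ heB (.rel _ _ (Or.inr ⟨F, hF, he, hf⟩))

/-- A nonempty proper part of a block is left by some cycle. -/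
theorem IsBlock.exists_cycle {G : MGraph V E} {B H : Set E} (hB : G.IsBlock B) (hHB : H ⊆ B)
    (hne : H.Nonempty) (hneq : H ≠ B) :
    ∃ F, G.IsCycleSet F ∧ ∃ e ∈ F, e ∈ H ∧ ∃ f ∈ F, f ∉ H := by
  by_contra! hcon
  refine hneq (hHB.antisymm fun f hf => ?_)
  obtain ⟨e, he⟩ := hne
  have heB := hHB he
  obtain ⟨e₀, rfl⟩ := hB
  exact (eqvGen_cycRel_mem_iff hcon (.trans _ _ _ (.symm _ _ heB) hf)).1 he

/-- A nonempty proper part of a block has an ear inside the block. -/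
theorem IsBlock.exists_ear {G : MGraph V E} {B H : Set E} (hB : G.IsBlock B) (hHB : H ⊆ B)
    (hne : H.Nonempty) (hneq : H ≠ B) :
    ∃ Q x y, x ≠ y ∧ G.IsPathSet Q x y ∧ x ∈ G.vtxOf H ∧ y ∈ G.vtxOf H ∧ Q ⊆ B ∧
      G.IntDisjoint Q H x y := by
  obtain ⟨F, hF, e, he, heH, f, hf, hfH⟩ := hB.exists_cycle hHB hne hneq
  obtain ⟨Q, x, y, hxy, hQ, hx, hy, hQF, hd⟩ := MGraph.exists_ear hF he heH hf hfH
  exact ⟨Q, x, y, hxy, hQ, hx, hy, hQF.trans (hB.cycle_subset hF he (hHB heH)), hd⟩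

theorem IsSubdivA.nonempty {G : MGraph V E} {H : Set E} (hH : G.IsSubdivA H) : H.Nonempty := by
  obtain ⟨t, ht, u, v, huv, P, hP, -, rfl⟩ := hH
  obtain ⟨e, he⟩ := (hP ⟨0, by omega⟩).nonempty huv
  exact ⟨e, Set.mem_iUnion.2 ⟨_, he⟩⟩

end MGraph

/-- if a connected (multi)graph `G` has no `K₄/e` minor, then every block
of `G` is a bridge, a cycle, or a subdivision of `A_t` for some `t ≥ 3`. -/
theorem stmt16 {V E : Type*} [Fintype V] [Fintype E] (G : MGraph V E)
    (hconn : G.Connected) (hminor : ¬ G.HasK4eMinor) :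
    ∀ B : Set E, G.IsBlock B →
      (∃ e : E, B = {e} ∧ G.IsBridge e) ∨ G.IsCycleSet B ∨ G.IsSubdivA B := by
  intro B hB
  obtain ⟨e, heB⟩ : B.Nonempty := by
    obtain ⟨e, rfl⟩ := hB
    exact ⟨e, .refl e⟩
  by_cases he : G.IsBridge e
  · left
    by_contra! hcon
    obtain ⟨F, hF, f, hf, rfl, -⟩ := hB.exists_cycle (Set.singleton_subset_iff.2 heB)
      (Set.singleton_nonempty e) fun h => hcon e h.symm he
    exact he F hF hf
  right
  simp only [MGraph.IsBridge, not_forall, not_not] at he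
  obtain ⟨F, hF, heF⟩ := he
  have hFB := hB.cycle_subset hF heF heB
  by_cases hFeq : F = B
  · exact Or.inl (hFeq ▸ hF)
  right
  obtain ⟨Q, x, y, hxy, hQ, hx, hy, hQB, hd⟩ := hB.exists_ear hFB ⟨e, heF⟩ hFeq
  obtain ⟨H, hmax⟩ := (Set.toFinite {H : Set E | G.IsSubdivA H ∧ H ⊆ B}).exists_maximal
    ⟨Q ∪ F, hF.isSubdivA_union_ear hxy hQ hx hy hd, Set.union_subset hQB hFB⟩
  obtain ⟨hH, hHB⟩ := hmax.prop
  by_cases hHeq : H = B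
  · exact hHeq ▸ hH
  obtain ⟨Q', x', y', hxy', hQ', hx', hy', hQB', hd'⟩ := hB.exists_ear hHB hH.nonempty hHeq
  have hle := hmax.le_of_ge ⟨hH.union_ear hminor hxy' hQ' hx' hy' hd',
    Set.union_subset hQB' hHB⟩ Set.subset_union_right
  obtain ⟨f, hf⟩ := hQ'.nonempty hxy'
  exact absurd (hle (Or.inl hf)) (hd'.notMem hf)
end
end

section
/- Let q be a power of 2 greater than 4, and let S be a subspace of GF(q)^3 with Matroid(S) isomorphic to the cycle matroid of A_3 (equivalently, S isomorphic via coordinate scalings to {x in GF(q)^3 : x_1+x_2+x_3 = 0}). Then mult(S) has C_5^2 as a clutter minor. -/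
open scoped Classical
noncomputable section

/-- The inclusion-wise minimal sets of a family. -/
def minimalSets {V : Type*} (F : Finset (Finset V)) : Finset (Finset V) :=
  F.filter fun A => ∀ B ∈ F, B ⊆ A → B = A

/-- The minor `C \ I / J` obtained after deleting `I` and contracting `J`. -/
def minorCl {V : Type*} (C : Finset (Finset V)) (I J : Finset V) : Finset (Finset V) :=
  minimalSets ((C.filter fun A => A ∩ I = ∅).image fun A => A \ J)

/-- `C` has (a clutter isomorphic to) `D` as a minor. -/
def HasMinorIso {V W : Type*} (C : Finset (Finset V)) (D : Finset (Finset W)) : Prop :=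
  ∃ (I J : Finset V) (φ : W → V), Disjoint I J ∧ Function.Injective φ ∧
    minorCl C I J = D.image fun A => A.image φ

/-- The support of a vector. -/
def suppF {ι : Type*} [Fintype ι] {F : Type*} [Zero F] (x : ι → F) : Finset ι :=
  Finset.univ.filter fun i => x i ≠ 0

/-- The circuits of `Matroid(S)`: the minimal supports of nonzero vectors of `S`. -/
def circuitSet {F : Type*} [Field F] {ι : Type*} [Fintype ι] (S : Submodule F (ι → F)) :
    Set (Finset ι) :=
  {C | (∃ x ∈ S, x ≠ 0 ∧ suppF x = C) ∧
       ∀ C', (∃ x ∈ S, x ≠ 0 ∧ suppF x = C') → C' ⊆ C → C' = C}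

/-- The multipartite uniform clutter of a subspace. -/
def multSub {F : Type*} [Field F] [Fintype F] {ι : Type*} [Fintype ι]
    (S : Submodule F (ι → F)) : Finset (Finset (Σ _ : ι, F)) :=
  (Finset.univ.filter fun x : ι → F => x ∈ S).image
    fun x => Finset.univ.image fun i => (⟨i, x i⟩ : Σ _ : ι, F)

/-- `C₅²`, the clutter of edges of the 5-cycle. -/
def C52 : Finset (Finset (Fin 5)) := {{0, 1}, {1, 2}, {2, 3}, {3, 4}, {4, 0}}

/-- A family all of whose members have the same size is its own family of minimal sets. -/
theorem minimalSets_eq_self_of_card_eq {V : Type*} {F : Finset (Finset V)} {n : ℕ}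
    (h : ∀ A ∈ F, A.card = n) : minimalSets F = F :=
  Finset.filter_true_of_mem fun A hA B hB hBA =>
    Finset.eq_of_subset_of_card_le hBA (by rw [h A hA, h B hB])

/-- To exhibit `D` as a minor of `C` it suffices to embed the ground set of `D` and to choose a
disjoint set `J` to contract such that the traces of those members of `C` which only use elements
of these two sets are the members of `D`. -/
theorem hasMinorIso_of_traces {V W : Type*} [Finite V] {C : Finset (Finset V)}
    {D : Finset (Finset W)} {n : ℕ} (hD : ∀ B ∈ D, B.card = n) (J : Finset V) (φ : W → V)
    (hφ : Function.Injective φ) (hφJ : ∀ w, φ w ∉ J)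
    (h_trace : ∀ M ∈ C, (∀ v ∈ M, v ∈ Set.range φ ∨ v ∈ J) → ∃ B ∈ D, ∀ w, φ w ∈ M ↔ w ∈ B)
    (h_surj : ∀ B ∈ D, ∃ M ∈ C, (∀ v ∈ M, v ∈ Set.range φ ∨ v ∈ J) ∧ ∀ w, φ w ∈ M ↔ w ∈ B) :
    HasMinorIso C D := by
  have := Fintype.ofFinite V
  have h_sdiff : ∀ (M : Finset V) (B : Finset W), (∀ v ∈ M, v ∈ Set.range φ ∨ v ∈ J) →
      (∀ w, φ w ∈ M ↔ w ∈ B) → M \ J = B.image φ := by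
    intro M B hM hB
    ext v
    simp only [Finset.mem_sdiff, Finset.mem_image]
    constructor
    · rintro ⟨hv, hvJ⟩
      obtain ⟨w, rfl⟩ := (hM v hv).resolve_right hvJ
      exact ⟨w, (hB w).mp hv, rfl⟩
    · rintro ⟨w, hw, rfl⟩
      exact ⟨(hB w).mpr hw, hφJ w⟩
  let I : Finset V := Finset.univ.filter fun v => ¬(v ∈ Set.range φ ∨ v ∈ J)
  have hI : ∀ M : Finset V, M ∩ I = ∅ ↔ ∀ v ∈ M, v ∈ Set.range φ ∨ v ∈ J := by
    intro M
    simp only [I, ← Finset.disjoint_iff_inter_eq_empty, Finset.disjoint_left, Finset.mem_filter,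
      Finset.mem_univ, true_and, not_not]
  refine ⟨I, J, φ, ?_, hφ, ?_⟩
  · rw [Finset.disjoint_left]
    intro v hv hvJ
    exact (Finset.mem_filter.mp hv).2 (Or.inr hvJ)
  · have h_eq : (C.filter fun A => A ∩ I = ∅).image (fun A => A \ J) =
        D.image fun A => A.image φ := by
      ext A
      simp only [Finset.mem_image, Finset.mem_filter, hI]
      constructor
      · rintro ⟨M, ⟨hMC, hM⟩, rfl⟩
        obtain ⟨B, hBD, hB⟩ := h_trace M hMC hM
        exact ⟨B, hBD, (h_sdiff M B hM hB).symm⟩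
      · rintro ⟨B, hBD, rfl⟩
        obtain ⟨M, hMC, hM, hB⟩ := h_surj B hBD
        exact ⟨M, ⟨hMC, hM⟩, h_sdiff M B hM hB⟩
    rw [minorCl, h_eq]
    refine minimalSets_eq_self_of_card_eq (n := n) fun A hA => ?_
    obtain ⟨B, hB, rfl⟩ := Finset.mem_image.mp hA
    rw [Finset.card_image_of_injective _ hφ, hD B hB]

/-- The criterion `hasMinorIso_of_traces` for the multipartite uniform clutter of a subspace. -/
theorem hasMinorIso_multSub_of_traces {F ι W : Type*} [Field F] [Fintype F] [Fintype ι]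
    {S : Submodule F (ι → F)} {D : Finset (Finset W)} {n : ℕ} (hD : ∀ B ∈ D, B.card = n)
    (J : Finset (Σ _ : ι, F)) (φ : W → Σ _ : ι, F) (hφ : Function.Injective φ)
    (hφJ : ∀ w, φ w ∉ J)
    (h_trace : ∀ v ∈ S, (∀ i, ⟨i, v i⟩ ∈ Set.range φ ∨ ⟨i, v i⟩ ∈ J) →
      ∃ B ∈ D, ∀ w, v (φ w).1 = (φ w).2 ↔ w ∈ B)
    (h_surj : ∀ B ∈ D, ∃ v ∈ S, (∀ i, ⟨i, v i⟩ ∈ Set.range φ ∨ ⟨i, v i⟩ ∈ J) ∧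
      ∀ w, v (φ w).1 = (φ w).2 ↔ w ∈ B) :
    HasMinorIso (multSub S) D := by
  have h_mem : ∀ (v : ι → F) (p : Σ _ : ι, F),
      p ∈ Finset.univ.image (fun i => (⟨i, v i⟩ : Σ _ : ι, F)) ↔ v p.1 = p.2 := by
    rintro v ⟨i, t⟩
    simp
  refine hasMinorIso_of_traces hD J φ hφ hφJ ?_ ?_
  · simpa only [multSub, Finset.forall_mem_image, Finset.mem_filter, Finset.mem_univ, true_and,
      h_mem, Sigma.forall, forall_eq'] using h_trace
  · simpa only [multSub, Finset.exists_mem_image, Finset.mem_filter, Finset.mem_univ, true_and,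
      h_mem, Sigma.forall, forall_eq'] using h_surj

/-- A subspace of `F³` whose circuits are the 2-element sets is a plane in general position. -/
theorem exists_mem_iff_of_circuitSet_eq {F : Type*} [Field F] {S : Submodule F (Fin 3 → F)}
    (hA : circuitSet S = {C : Finset (Fin 3) | C.card = 2}) :
    ∃ a b c : F, a ≠ 0 ∧ b ≠ 0 ∧ c ≠ 0 ∧
      ∀ x : Fin 3 → F, x ∈ S ↔ a * x 0 + b * x 1 + c * x 2 = 0 := by
  have h_single : ∀ w ∈ S, w 0 = 0 → w 2 = 0 → w 1 = 0 := by
    intro w hw h0 h2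
    by_contra h1
    have h_supp : suppF w = {1} := by
      ext i
      fin_cases i <;> simp [suppF, h0, h1, h2]
    have h_circ : ({1} : Finset (Fin 3)) ∈ circuitSet S := by
      refine ⟨⟨w, hw, fun h => h1 (by simp [h]), h_supp⟩, ?_⟩
      rintro C ⟨x, -, hx, rfl⟩ hC
      refine (Finset.subset_singleton_iff.mp hC).resolve_left fun h => hx ?_
      funext i
      by_contra hi
      have : i ∈ suppF x := by simpa [suppF] using hi
      simp [h] at this
    rw [hA] at h_circ
    simp at h_circ
  have hu : ({0, 1} : Finset (Fin 3)) ∈ circuitSet S := by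
    rw [hA]
    exact Finset.card_pair (by decide)
  have hv : ({1, 2} : Finset (Fin 3)) ∈ circuitSet S := by
    rw [hA]
    exact Finset.card_pair (by decide)
  obtain ⟨⟨u, huS, -, hu⟩, -⟩ := hu
  obtain ⟨⟨v, hvS, -, hv⟩, -⟩ := hv
  simp only [Finset.ext_iff, suppF, Fin.forall_fin_succ] at hu hv
  simp at hu hv
  obtain ⟨hu0, hu1, hu2⟩ := hu
  obtain ⟨hv0, hv1, hv2⟩ := hv
  refine ⟨u 1 * v 2, -(u 0 * v 2), u 0 * v 1, mul_ne_zero hu1 hv2,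
    neg_ne_zero.mpr (mul_ne_zero hu0 hv2), mul_ne_zero hu0 hv1,
    fun x => ⟨fun hx => ?_, fun hx => ?_⟩⟩
  · have h := h_single (x - (x 0 / u 0) • u - (x 2 / v 2) • v)
      (S.sub_mem (S.sub_mem hx (S.smul_mem _ huS)) (S.smul_mem _ hvS))
      (by simp [hu0, hv0]) (by simp [hu2, hv2])
    simp only [Pi.sub_apply, Pi.smul_apply, smul_eq_mul] at h
    field_simp at h
    linear_combination -h
  · have h : x = (x 0 / u 0) • u + (x 2 / v 2) • v := by
      funext i
      fin_cases i
      · simp [hu0, hv0]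
      · simp only [Fin.mk_one, Pi.add_apply, Pi.smul_apply, smul_eq_mul]
        field_simp
        linear_combination -hx
      · simp [hu2, hv2]
    rw [h]
    exact S.add_mem (S.smul_mem _ huS) (S.smul_mem _ hvS)

/-- A field with more than four elements contains distinct nonzero `x`, `y`, `z` with `z ≠ x + y`.
In characteristic two these are linearly independent over the prime field. -/
theorem exists_independent_triple {F : Type*} [Field F] [Fintype F] (hq4 : 4 < Fintype.card F) :
    ∃ x y z : F, x ≠ 0 ∧ y ≠ 0 ∧ y ≠ x ∧ z ≠ 0 ∧ z ≠ x ∧ z ≠ y ∧ z ≠ x + y := by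
  have h_new : ∀ s : Finset F, s.card ≤ 4 → ∃ z, z ∉ s := fun s hs => by
    by_contra! h
    have := Finset.card_eq_iff_eq_univ s |>.mpr (Finset.eq_univ_of_forall h)
    omega
  obtain ⟨y, hy⟩ := h_new {0, 1} (Finset.card_le_two.trans (by norm_num))
  obtain ⟨z, hz⟩ := h_new {0, 1, y, 1 + y} Finset.card_le_four
  simp only [Finset.mem_insert, Finset.mem_singleton, not_or] at hy hz
  exact ⟨1, y, z, one_ne_zero, hy.1, hy.2, hz⟩

/-- let `q = 2^k > 4` and let `S ⊆ GF(q)^3` be a subspace whose matroid is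
(isomorphic to) the cycle matroid of `A₃`, i.e. whose circuits are exactly the 2-element
subsets of `[3]`.  Then `mult S` has `C₅²` as a clutter minor. -/
theorem stmt18 {F : Type*} [Field F] [Fintype F] (k : ℕ)
    (hq : Fintype.card F = 2 ^ k) (hq4 : 4 < Fintype.card F)
    (S : Submodule F (Fin 3 → F))
    (hA : circuitSet S = {C : Finset (Fin 3) | C.card = 2}) :
    HasMinorIso (multSub S) C52 := by
  have h2 : (2 : F) = 0 := by
    have h := FiniteField.cast_card_eq_zero F
    rw [hq, Nat.cast_pow] at h
    simpa using eq_zero_of_pow_eq_zero h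
  obtain ⟨a, b, c, ha, hb, hc, hS⟩ := exists_mem_iff_of_circuitSet_eq hA
  obtain ⟨x, y, z, hx, hy, hyx, hz, hzx, hzy, hzxy⟩ := exists_independent_triple hq4
  let φ : Fin 5 → (Σ _ : Fin 3, F) := ![⟨0, 0⟩, ⟨1, x / b⟩, ⟨0, y / a⟩, ⟨1, 0⟩, ⟨2, z / c⟩]
  let J : Finset (Σ _ : Fin 3, F) :=
    {⟨0, z / a⟩, ⟨1, z / b⟩, ⟨2, x / c⟩, ⟨2, (x + y) / c⟩, ⟨2, y / c⟩}
  have h_inj : Function.Injective φ := by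
    intro i j
    fin_cases i <;> fin_cases j <;> simp [φ, ha, hb, hx, hy, eq_comm]
  have hφJ : ∀ i, φ i ∉ J := by
    intro i
    fin_cases i <;> simp [φ, J, div_left_inj', *, Ne.symm]
  let e : Fin 5 → Fin 3 → F := ![![0, x / b, x / c], ![y / a, x / b, (x + y) / c],
    ![y / a, 0, y / c], ![z / a, 0, z / c], ![0, z / b, z / c]]
  have h_usable : ∀ v : Fin 3 → F,
      (∀ i, (⟨i, v i⟩ : Σ _ : Fin 3, F) ∈ Set.range φ ∨ (⟨i, v i⟩ : Σ _ : Fin 3, F) ∈ J) ↔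
        (v 0 = y / a ∨ v 0 = 0 ∨ v 0 = z / a) ∧ (v 1 = 0 ∨ v 1 = x / b ∨ v 1 = z / b) ∧
        (v 2 = z / c ∨ v 2 = x / c ∨ v 2 = (x + y) / c ∨ v 2 = y / c) := by
    intro v
    simp [φ, J, Fin.forall_fin_succ, or_assoc]
  have h_solutions : ∀ v : Fin 3 → F,
      (v ∈ S ∧ ∀ i, (⟨i, v i⟩ : Σ _ : Fin 3, F) ∈ Set.range φ ∨ (⟨i, v i⟩ : Σ _ : Fin 3, F) ∈ J) ↔
      ∃ i, v = e i := by
    intro v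
    have h_ext : ∀ r s t, v = ![r, s, t] ↔ v 0 = r ∧ v 1 = s ∧ v 2 = t := by
      intro r s t
      simp [funext_iff, Fin.forall_fin_succ]
    simp only [hS, h_usable, e, Fin.exists_fin_succ, IsEmpty.exists_iff, Matrix.cons_val_zero,
      Matrix.cons_val_succ, h_ext, or_false]
    simp only [eq_div_iff ha, eq_div_iff hb, eq_div_iff hc]
    have h0 : v 0 = 0 ↔ v 0 * a = 0 := by simp [ha]
    have h1 : v 1 = 0 ↔ v 1 * b = 0 := by simp [hb]
    rw [h0, h1, mul_comm a, mul_comm b, mul_comm c]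
    generalize v 0 * a = r
    generalize v 1 * b = s
    generalize v 2 * c = t
    constructor
    · rintro ⟨h, h0, h1, h2⟩
      rcases h0 with rfl | rfl | rfl <;> rcases h1 with rfl | rfl | rfl <;> grind
    · grind
  have h_trace : ∀ i w, e i (φ w).1 = (φ w).2 ↔ w ∈ ({i, i + 1} : Finset (Fin 5)) := by
    intro i w
    fin_cases i <;> fin_cases w <;> simp [e, φ, div_left_inj', *, Ne.symm]
  have h_edges : ∀ B, B ∈ C52 ↔ ∃ i, B = {i, i + 1} := by
    intro B
    simp [C52, Fin.exists_fin_succ]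
  refine hasMinorIso_multSub_of_traces (n := 2) (by simp [C52]) J φ h_inj hφJ ?_ ?_
  · intro v hvS hv
    obtain ⟨i, rfl⟩ := (h_solutions v).mp ⟨hvS, hv⟩
    exact ⟨_, (h_edges _).mpr ⟨i, rfl⟩, h_trace i⟩
  · intro B hB
    obtain ⟨i, rfl⟩ := (h_edges B).mp hB
    obtain ⟨hS, h⟩ := (h_solutions (e i)).mpr ⟨i, rfl⟩
    exact ⟨e i, hS, h, h_trace i⟩
end
end
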